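/- Sharp weak reverse Hölder inequality for one-sided weights: if w ∈ A₁⁺ and r_w = 1 + 1/(16 e^{1/e} ‖w‖_{A₁⁺}), then for every bounded interval (a,b), ∫_a^b w^{r_w} ≤ 2 (M⁻(wχ_{(a,b)})(b))^{r_w−1} ∫_a^b w. -/

import Mathlib

open MeasureTheory Set Filter FourierTransform ENNReal NNReal

noncomputable section

/-- One-sided (left) Hardy–Littlewood maximal operator. -/
def Mminus (f : ℝ → ℝ) (x : ℝ) : ℝ≥0∞ :=
  ⨆ (h : ℝ) (_ : 0 < h),
    (∫⁻ t in Set.Ioc (x - h) x, ENNReal.ofReal |f t|) / ENNReal.ofReal h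

/-- One-sided (right) Hardy–Littlewood maximal operator. -/
def Mplus (f : ℝ → ℝ) (x : ℝ) : ℝ≥0∞ :=
  ⨆ (h : ℝ) (_ : 0 < h),
    (∫⁻ t in Set.Ioc x (x + h), ENNReal.ofReal |f t|) / ENNReal.ofReal h

/-- One-sided (left) maximal operator with exponent `r`. -/
def MminusR (r : ℝ) (f : ℝ → ℝ) (x : ℝ) : ℝ≥0∞ :=
  ⨆ (h : ℝ) (_ : 0 < h),
    ((∫⁻ t in Set.Ioc (x - h) x, ENNReal.ofReal (|f t| ^ r)) / ENNReal.ofReal h) ^ (1 / r)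

/-- `w ∈ A₁⁺` with constant `C` : `M⁻w ≤ C w` a.e. -/
def A1PlusWith (w : ℝ → ℝ) (C : ℝ) : Prop :=
  ∀ᵐ x : ℝ, Mminus w x ≤ ENNReal.ofReal (C * w x)

/-- `w ∈ A₁⁻` with constant `C` : `M⁺w ≤ C w` a.e. -/
def A1MinusWith (w : ℝ → ℝ) (C : ℝ) : Prop :=
  ∀ᵐ x : ℝ, Mplus w x ≤ ENNReal.ofReal (C * w x)

/-- `w ∈ A_p⁺` with constant `C`, for `1 < p`. -/
def ApPlusWith (p : ℝ) (w : ℝ → ℝ) (C : ℝ) : Prop :=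
  ∀ a x b : ℝ, a < x → x < b →
    (∫ t in Set.Ioo a x, w t) *
      (∫ t in Set.Ioo x b, (w t) ^ (-1 / (p - 1))) ^ (p - 1) ≤ C * (b - a) ^ p

/-- `w ∈ A_p⁻` with constant `C`, for `1 < p`. -/
def ApMinusWith (p : ℝ) (w : ℝ → ℝ) (C : ℝ) : Prop :=
  ∀ a x b : ℝ, a < x → x < b →
    (∫ t in Set.Ioo x b, w t) *
      (∫ t in Set.Ioo a x, (w t) ^ (-1 / (p - 1))) ^ (p - 1) ≤ C * (b - a) ^ p

/-- A Calderón–Zygmund kernel on `ℝ` with support in the set `S` and constants `c₁ c₂ c₃`. -/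
def IsOneSidedCZKernel (K : ℝ → ℝ) (S : Set ℝ) (c₁ c₂ c₃ : ℝ) : Prop :=
  MeasureTheory.LocallyIntegrableOn K {x : ℝ | x ≠ 0} volume ∧
  Function.support K ⊆ S ∧
  (∀ ξ : ℝ, ‖𝓕 (fun x : ℝ => (K x : ℂ)) ξ‖ ≤ c₁) ∧
  (∀ x : ℝ, x ≠ 0 → |K x| ≤ c₂ / |x|) ∧
  (∀ x y : ℝ, |y| < |x| / 2 → |K x - K (x - y)| ≤ c₃ * |y| / x ^ 2)

/-- `T⁺` : one-sided singular integral with kernel supported in `(-∞,0)`. -/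
def Tplus (K : ℝ → ℝ) (f : ℝ → ℝ) (x : ℝ) : ℝ :=
  limUnder (nhdsWithin (0:ℝ) (Set.Ioi 0)) fun ε => ∫ y in Set.Ioi (x + ε), K (x - y) * f y

/-- `T⁻` : one-sided singular integral with kernel supported in `(0,∞)`. -/
def Tminus (K : ℝ → ℝ) (f : ℝ → ℝ) (x : ℝ) : ℝ :=
  limUnder (nhdsWithin (0:ℝ) (Set.Ioi 0)) fun ε => ∫ y in Set.Iic (x - ε), K (x - y) * f y

/-- Maximal truncated operator associated to the kernel `K`. -/
def Tstar (K : ℝ → ℝ) (f : ℝ → ℝ) (x : ℝ) : ℝ≥0∞ :=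
  ⨆ (ε : ℝ) (_ : 0 < ε),
    ∫⁻ y in {y : ℝ | ε < |x - y|}, ENNReal.ofReal (|K (x - y)| * |f y|)

/-- Weighted `L^p` norm `‖g‖_{L^p(w)}`. -/
def wLpNorm (p : ℝ) (w g : ℝ → ℝ) : ℝ≥0∞ :=
  (∫⁻ x : ℝ, ENNReal.ofReal (|g x| ^ p * w x)) ^ (1 / p)

/-- Weighted measure `w(E) = ∫_E w`. -/
def wMeasure (w : ℝ → ℝ) (E : Set ℝ) : ℝ≥0∞ :=
  ∫⁻ x in E, ENNReal.ofReal (w x)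

/-- A bounded open connected subset of `ℝ` is an open interval. -/
theorem IsOpen.eq_Ioo_of_isConnected {C : Set ℝ} (hC : IsOpen C) (hc : IsConnected C)
    (hb : BddBelow C) (ha : BddAbove C) : C = Ioo (sInf C) (sSup C) := by
  refine Subset.antisymm (fun x hx => ?_) (hc.Ioo_csInf_csSup_subset hb ha)
  obtain ⟨ε, hε, hball⟩ := Metric.isOpen_iff.1 hC x hx
  have h₁ : x - ε / 2 ∈ C := hball (by rw [Real.ball_eq_Ioo]; constructor <;> linarith)
  have h₂ : x + ε / 2 ∈ C := hball (by rw [Real.ball_eq_Ioo]; constructor <;> linarith)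
  have h₃ := csInf_le hb h₁
  have h₄ := le_csSup ha h₂
  constructor <;> linarith

/-- The right endpoint of a component of a bounded open subset of `ℝ` is outside the set. -/
theorem IsOpen.sSup_connectedComponentIn_notMem {E : Set ℝ} (hE : IsOpen E) (ha : BddAbove E)
    {x : ℝ} (hx : x ∈ E) : sSup (connectedComponentIn E x) ∉ E := by
  intro hmem
  set C := connectedComponentIn E x with hC
  have hsub : C ⊆ E := connectedComponentIn_subset E x
  have hxC : x ∈ C := mem_connectedComponentIn hx
  have hbdd : BddAbove C := ha.mono hsub
  have hcl : sSup C ∈ closure C := csSup_mem_closure ⟨x, hxC⟩ hbdd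
  have hins : insert (sSup C) C ⊆ C := by
    refine IsPreconnected.subset_connectedComponentIn ?_ (mem_insert_of_mem _ hxC)
      (insert_subset hmem hsub)
    exact isPreconnected_connectedComponentIn.subset_closure (subset_insert _ _)
      (insert_subset hcl subset_closure)
  obtain ⟨ε, hε, hball⟩ := Metric.isOpen_iff.1 (hE.connectedComponentIn (x := x)) _
    (hins (mem_insert _ _))
  have h₂ : sSup C + ε / 2 ∈ C := hball (by rw [Real.ball_eq_Ioo]; constructor <;> linarith)
  have := le_csSup hbdd h₂
  linarith

/-- If a measure is dominated by another one on all intervals contained in a bounded open set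
whose right endpoint is outside that set, then it is dominated on the whole set. -/
theorem IsOpen.measure_le_of_forall_Ioo {μ ν : Measure ℝ} {E : Set ℝ} (hE : IsOpen E)
    (hb : BddBelow E) (ha : BddAbove E)
    (h : ∀ α β : ℝ, α < β → β ∉ E → Ioo α β ⊆ E → μ (Ioo α β) ≤ ν (Ioo α β)) :
    μ E ≤ ν E := by
  set S : Set (Set ℝ) := connectedComponentIn E '' E with hS
  have hopen : ∀ s ∈ S, IsOpen s := by
    rintro _ ⟨x, -, rfl⟩
    exact hE.connectedComponentIn
  have hdisj : S.PairwiseDisjoint id := by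
    rintro _ ⟨x, hx, rfl⟩ _ ⟨y, hy, rfl⟩ hne
    refine Set.disjoint_left.2 fun z hzx hzy => hne ?_
    exact (connectedComponentIn_eq hzx).trans (connectedComponentIn_eq hzy).symm
  have hcount : S.Countable := by
    refine hdisj.countable_of_isOpen hopen ?_
    rintro _ ⟨x, hx, rfl⟩
    exact ⟨x, mem_connectedComponentIn hx⟩
  have hU : ⋃₀ S = E := by
    refine Subset.antisymm (sUnion_subset ?_) fun x hx =>
      ⟨_, mem_image_of_mem _ hx, mem_connectedComponentIn hx⟩
    rintro _ ⟨x, -, rfl⟩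
    exact connectedComponentIn_subset E x
  rw [← hU, measure_sUnion hcount hdisj fun s hs => (hopen s hs).measurableSet,
    measure_sUnion hcount hdisj fun s hs => (hopen s hs).measurableSet]
  refine ENNReal.tsum_le_tsum ?_
  rintro ⟨_, x, hx, rfl⟩
  have hsub := connectedComponentIn_subset E x
  have heq := (hE.connectedComponentIn (x := x)).eq_Ioo_of_isConnected
    (isConnected_connectedComponentIn_iff.2 hx) (hb.mono hsub) (ha.mono hsub)
  have hmem : x ∈ Ioo _ _ := heq ▸ mem_connectedComponentIn hx
  have := h _ _ (hmem.1.trans hmem.2) (hE.sSup_connectedComponentIn_notMem ha hx) (heq ▸ hsub)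
  rwa [← heq] at this

/-- One-sided Lebesgue differentiation: almost every value of a locally integrable function is
approached from below by averages over short intervals to the left. -/
theorem MeasureTheory.LocallyIntegrable.ae_exists_mul_sub_lt_integral {w : ℝ → ℝ}
    (hw : LocallyIntegrable w volume) :
    ∀ᵐ x : ℝ, ∀ s < w x, ∀ a < x, ∃ y ∈ Ioo a x, s * (x - y) < ∫ u in y..x, w u := by
  have hint (c d : ℝ) : IntervalIntegrable w volume c d :=
    (hw.integrableOn_isCompact isCompact_uIcc).intervalIntegrable
  filter_upwards [_root_.LocallyIntegrable.ae_hasDerivAt_integral hw] with x hx s hs a hax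
  have hd := (hx a).hasDerivWithinAt (s := Iio x)
  rw [hasDerivWithinAt_iff_tendsto_slope' (by simp)] at hd
  have hev := (hd.eventually (lt_mem_nhds hs)).and (Ioo_mem_nhdsLT hax)
  obtain ⟨y, hy, hya⟩ := hev.exists
  refine ⟨y, hya, ?_⟩
  rw [slope_comm, slope_def_field, lt_div_iff₀ (sub_pos.2 hya.2),
    intervalIntegral.integral_interval_sub_left (hint _ _) (hint _ _)] at hy
  exact hy

/-- The left maximal function dominates the averages over intervals to the left. -/
theorem ofReal_lt_Mminus {w : ℝ → ℝ} (hw : ∀ x, 0 ≤ w x) (hwl : LocallyIntegrable w volume)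
    {s x y : ℝ} (hyx : y < x) (h : s * (x - y) < ∫ u in y..x, w u) (hs : 0 ≤ s) :
    ENNReal.ofReal s < Mminus w x := by
  have hpos := sub_pos.2 hyx
  have hint : IntervalIntegrable w volume y x :=
    (hwl.integrableOn_isCompact isCompact_uIcc).intervalIntegrable
  refine lt_of_lt_of_le ?_ (le_iSup₂ (x - y) hpos)
  simp_rw [_root_.sub_sub_cancel, abs_of_nonneg (hw _)]
  rw [← ofReal_integral_eq_lintegral_ofReal hint.1 (ae_of_all _ hw),
    ← intervalIntegral.integral_of_le hyx.le, ← ENNReal.ofReal_div_of_pos hpos]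
  exact (ENNReal.ofReal_lt_ofReal_iff_of_nonneg hs).2 ((lt_div_iff₀ hpos).2 h)

/-- The maximal function at `b` controls the averages over the intervals ending at `b`. -/
theorem integral_le_of_Mminus_indicator_le {w : ℝ → ℝ} (hw : ∀ x, 0 ≤ w x)
    (hwl : LocallyIntegrable w volume) {a b y t : ℝ} (hay : a ≤ y) (hyb : y < b) (ht : 0 ≤ t)
    (h : Mminus ((Ioo a b).indicator w) b ≤ ENNReal.ofReal t) :
    ∫ u in y..b, w u ≤ t * (b - y) := by
  have hpos := sub_pos.2 hyb
  have hint : IntervalIntegrable w volume y b :=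
    (hwl.integrableOn_isCompact isCompact_uIcc).intervalIntegrable
  have h₁ := (le_iSup₂ (f := fun (h : ℝ) (_ : 0 < h) =>
    (∫⁻ t in Set.Ioc (b - h) b, ENNReal.ofReal |(Ioo a b).indicator w t|) / ENNReal.ofReal h)
    (b - y) hpos).trans h
  have h₂ : ∫⁻ t in Ioc y b, ENNReal.ofReal |(Ioo a b).indicator w t| =
      ∫⁻ t in Ioc y b, ENNReal.ofReal (w t) := by
    rw [setLIntegral_congr Ioo_ae_eq_Ioc.symm, setLIntegral_congr Ioo_ae_eq_Ioc.symm]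
    refine setLIntegral_congr_fun measurableSet_Ioo fun u hu => ?_
    simp only [indicator_of_mem (show u ∈ Ioo a b from ⟨hay.trans_lt hu.1, hu.2⟩),
      abs_of_nonneg (hw u)]
  rw [_root_.sub_sub_cancel, h₂, ← ofReal_integral_eq_lintegral_ofReal hint.1 (ae_of_all _ hw),
    ← intervalIntegral.integral_of_le hyb.le, ← ENNReal.ofReal_div_of_pos hpos,
    ENNReal.ofReal_le_ofReal_iff ht] at h₁
  exact (div_le_iff₀ hpos).1 h₁

/-- The rising sun inequality for the left maximal function on `(a, b)`. -/
theorem exists_lintegral_le_mul_volume {w : ℝ → ℝ} (hw : ∀ x, 0 ≤ w x)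
    (hwl : LocallyIntegrable w volume) {a b t : ℝ} (ht : 0 ≤ t)
    (h : Mminus ((Ioo a b).indicator w) b ≤ ENNReal.ofReal t) :
    ∃ E ⊆ Ioo a b, MeasurableSet E ∧ (∀ᵐ x, x ∈ Ioo a b → t < w x → x ∈ E) ∧
      (∀ x ∈ E, ENNReal.ofReal t < Mminus w x) ∧
      ∫⁻ x in E, ENNReal.ofReal (w x) ≤ ENNReal.ofReal t * volume E := by
  have hint (c d : ℝ) : IntervalIntegrable w volume c d :=
    (hwl.integrableOn_isCompact isCompact_uIcc).intervalIntegrable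
  set E : Set ℝ := {x | x ∈ Ioo a b ∧ ∃ y ∈ Ico a x, t * (x - y) < ∫ u in y..x, w u} with hE
  have hEab : E ⊆ Ioo a b := fun x hx => hx.1
  have hopen : IsOpen E := by
    have : E = ⋃ y ∈ Ici a, Ioo a b ∩ Ioi y ∩ {x | t * (x - y) < ∫ u in y..x, w u} := by
      ext x
      simp only [hE, mem_ofPred_eq, mem_iUnion, mem_inter_iff, mem_Ico, mem_Ici, mem_Ioi,
        exists_prop]
      constructor
      · rintro ⟨h₁, y, h₂, h₃⟩
        exact ⟨y, h₂.1, ⟨h₁, h₂.2⟩, h₃⟩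
      · rintro ⟨y, h₁, ⟨h₂, h₃⟩, h₄⟩
        exact ⟨h₂, y, ⟨h₁, h₃⟩, h₄⟩
    rw [this]
    refine isOpen_biUnion fun y _ => (isOpen_Ioo.inter isOpen_Ioi).inter ?_
    exact isOpen_lt (by fun_prop) (intervalIntegral.continuous_primitive hint y)
  refine ⟨E, hEab, hopen.measurableSet, ?_, ?_, ?_⟩
  · filter_upwards [hwl.ae_exists_mul_sub_lt_integral] with x hx hxab htx
    obtain ⟨y, hy, hlt⟩ := hx t htx a hxab.1
    exact ⟨hxab, y, ⟨hy.1.le, hy.2⟩, hlt⟩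
  · rintro x ⟨-, y, hy, hlt⟩
    exact ofReal_lt_Mminus hw hwl hy.2 hlt ht
  · rw [← withDensity_apply _ hopen.measurableSet, ← smul_eq_mul, ← Measure.smul_apply]
    refine hopen.measure_le_of_forall_Ioo (bddBelow_Ioo.mono hEab) (bddAbove_Ioo.mono hEab) ?_
    intro α β hαβ hβ hsub
    obtain ⟨hα, hβb⟩ := (Ioo_subset_Ioo_iff hαβ).1 (hsub.trans hEab)
    have key : ∫ u in α..β, w u ≤ t * (β - α) := by
      rcases hβb.eq_or_lt with rfl | hlt
      · exact integral_le_of_Mminus_indicator_le hw hwl hα hαβ ht h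
      · by_contra! hcon
        exact hβ ⟨⟨hα.trans_lt hαβ, hlt⟩, α, ⟨hα, hαβ⟩, hcon⟩
    rw [withDensity_apply _ measurableSet_Ioo, setLIntegral_congr Ioo_ae_eq_Ioc,
      ← ofReal_integral_eq_lintegral_ofReal (hint α β).1 (ae_of_all _ hw),
      ← intervalIntegral.integral_of_le hαβ.le, Measure.smul_apply, Real.volume_Ioo, smul_eq_mul,
      ← ENNReal.ofReal_mul ht]
    exact ENNReal.ofReal_le_ofReal key

/-- The distributional form of the rising sun inequality for `A₁⁺` weights. -/
theorem A1PlusWith.measure_lt_le {w : ℝ → ℝ} (hw : ∀ x, 0 ≤ w x)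
    (hwl : LocallyIntegrable w volume) {K : ℝ} (hA : A1PlusWith w K) {a b t : ℝ} (ht : 0 ≤ t)
    (h : Mminus ((Ioo a b).indicator w) b ≤ ENNReal.ofReal t) :
    ((volume.restrict (Ioo a b)).withDensity fun x => ENNReal.ofReal (w x)) {x | t < w x} ≤
      ENNReal.ofReal t * volume.restrict (Ioo a b) {x | t < K * w x} := by
  obtain ⟨E, hEab, hEm, hsub, hM, hle⟩ := exists_lintegral_le_mul_volume hw hwl ht h
  have h₁ : ((volume.restrict (Ioo a b)).withDensity fun x => ENNReal.ofReal (w x))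
      {x | t < w x} ≤ ∫⁻ x in E, ENNReal.ofReal (w x) := by
    calc _ ≤ ((volume.restrict (Ioo a b)).withDensity fun x => ENNReal.ofReal (w x)) E := by
          refine measure_mono_ae ((withDensity_absolutelyContinuous _ _).ae_le ?_)
          filter_upwards [ae_restrict_of_ae hsub, ae_restrict_mem measurableSet_Ioo] with x hx hxab
          exact hx hxab
      _ = _ := by
          rw [withDensity_apply _ hEm, Measure.restrict_restrict hEm, inter_eq_left.2 hEab]
  refine (h₁.trans hle).trans (mul_le_mul_right ?_ _)
  rw [← inter_eq_left.2 hEab, ← Measure.restrict_apply hEm]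
  refine measure_mono_ae (ae_restrict_of_ae ?_)
  filter_upwards [hA] with x hx hxE
  exact (ENNReal.ofReal_lt_ofReal_iff_of_nonneg ht).1 ((hM x hxE).trans_le hx)

/-- A bound between distribution functions above a height `M` gives a bound between
moments. -/
theorem lintegral_rpow_le_of_measure_lt_le {α : Type*} [MeasurableSpace α] {μ ν : Measure α}
    {f g : α → ℝ} (hf : 0 ≤ f) (hg : 0 ≤ g) (hfm : AEMeasurable f μ) (hgm : AEMeasurable g ν)
    {M δ : ℝ} (hM : 0 ≤ M) (hδ : 0 < δ)
    (h : ∀ t, M ≤ t → μ {x | t < f x} ≤ ENNReal.ofReal t * ν {x | t < g x}) :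
    ∫⁻ x, ENNReal.ofReal (f x ^ δ) ∂μ ≤ ENNReal.ofReal (M ^ δ) * μ univ +
      ENNReal.ofReal (δ / (1 + δ)) * ∫⁻ x, ENNReal.ofReal (g x ^ (1 + δ)) ∂ν := by
  have hδ' : 0 < 1 + δ := by linarith
  rw [← lintegral_const (μ := μ) (ENNReal.ofReal (M ^ δ)),
    lintegral_rpow_eq_lintegral_meas_lt_mul μ (ae_of_all _ hf) hfm hδ,
    lintegral_rpow_eq_lintegral_meas_lt_mul μ (ae_of_all _ fun _ => hM) aemeasurable_const hδ,
    lintegral_rpow_eq_lintegral_meas_lt_mul ν (ae_of_all _ hg) hgm hδ', ← mul_assoc,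
    ← ENNReal.ofReal_mul (by positivity), div_mul_cancel₀ _ hδ'.ne', ← mul_add,
    ← lintegral_add_left]
  · refine mul_le_mul_right (setLIntegral_mono' measurableSet_Ioi fun t ht => ?_) _
    rcases lt_or_ge t M with htM | htM
    · refine le_add_right (mul_le_mul_left (measure_mono fun x _ => htM) _)
    · refine le_add_left ((mul_le_mul_left (h t htM) _).trans_eq ?_)
      have ht' : 0 < t := ht
      rw [mul_comm (ENNReal.ofReal t), mul_assoc, ← ENNReal.ofReal_mul ht'.le, add_sub_cancel_left,
        Real.rpow_sub_one ht'.ne', mul_div_cancel₀ _ ht'.ne']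
  · have : Antitone fun t : ℝ => μ {_x : α | t < M} :=
      fun s t hst => measure_mono fun x hx => hst.trans_lt hx
    exact this.measurable.mul (by fun_prop)

/-- The truncated form of the weak reverse Hölder inequality. -/
theorem A1PlusWith.lintegral_min_rpow_mul_le {w : ℝ → ℝ} (hw : ∀ x, 0 ≤ w x)
    (hwl : LocallyIntegrable w volume) {K : ℝ} (hA : A1PlusWith w K) (hK : 1 ≤ K) {δ : ℝ}
    (hδ : 0 < δ) (hδK : δ * K ^ (1 + δ) ≤ 1 / 2) {a b M : ℝ} (hM : 0 ≤ M)
    (h : Mminus ((Ioo a b).indicator w) b ≤ ENNReal.ofReal M) {N : ℝ} (hN : 0 ≤ N) :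
    ∫⁻ x in Ioo a b, ENNReal.ofReal (w x) * ENNReal.ofReal (min (w x) N ^ δ) ≤
      2 * ENNReal.ofReal (M ^ δ) * ∫⁻ x in Ioo a b, ENNReal.ofReal (w x) := by
  have hwm : AEMeasurable w (volume.restrict (Ioo a b)) :=
    hwl.aestronglyMeasurable.aemeasurable.restrict
  have hK0 : 0 < K := by linarith
  set ν := volume.restrict (Ioo a b) with hν
  set I := ∫⁻ x, ENNReal.ofReal (w x) ∂ν with hI
  set A := ∫⁻ x, ENNReal.ofReal (w x) * ENNReal.ofReal (min (w x) N ^ δ) ∂ν with hAdef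
  have hIfin : I ≠ ∞ := by
    have : IntegrableOn w (Ioo a b) volume :=
      (hwl.integrableOn_isCompact isCompact_Icc).mono_set Ioo_subset_Icc_self
    exact this.lintegral_lt_top.ne
  have hAfin : A ≠ ∞ := by
    refine ne_top_of_le_ne_top (ENNReal.mul_ne_top hIfin (ENNReal.ofReal_ne_top (r := N ^ δ))) ?_
    rw [hI, ← lintegral_mul_const' _ _ ENNReal.ofReal_ne_top]
    refine lintegral_mono fun x => mul_le_mul_right (ENNReal.ofReal_le_ofReal ?_) _
    exact Real.rpow_le_rpow (le_min (hw x) hN) (min_le_right _ _) hδ.le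
  have hkey := lintegral_rpow_le_of_measure_lt_le
    (μ := ν.withDensity fun x => ENNReal.ofReal (w x)) (ν := ν)
    (f := fun x => min (w x) N) (g := fun x => min (K * w x) N)
    (fun x => le_min (hw x) hN) (fun x => le_min (mul_nonneg hK0.le (hw x)) hN)
    ((hwm.min aemeasurable_const).mono_ac (withDensity_absolutelyContinuous _ _))
    ((hwm.const_mul K).min aemeasurable_const) hM hδ ?_
  · rw [withDensity_apply _ MeasurableSet.univ, Measure.restrict_univ,
      lintegral_withDensity_eq_lintegral_mul₀ hwm.ennreal_ofReal
        ((hwm.min aemeasurable_const).pow_const δ).ennreal_ofReal] at hkey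
    change A ≤ ENNReal.ofReal (M ^ δ) * I + _ at hkey
    have hg : ∫⁻ x, ENNReal.ofReal (min (K * w x) N ^ (1 + δ)) ∂ν ≤
        ENNReal.ofReal (K ^ (1 + δ)) * A := by
      rw [hAdef, ← lintegral_const_mul' _ _ ENNReal.ofReal_ne_top]
      refine lintegral_mono fun x => ?_
      dsimp only
      rw [← ENNReal.ofReal_mul (hw x), ← ENNReal.ofReal_mul (by positivity)]
      refine ENNReal.ofReal_le_ofReal ?_
      have h₀ : 0 ≤ min (K * w x) N := le_min (mul_nonneg hK0.le (hw x)) hN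
      have h₁ : min (K * w x) N ≤ K * min (w x) N := by
        rw [mul_min_of_nonneg _ _ hK0.le]
        exact min_le_min le_rfl (le_mul_of_one_le_left hN hK)
      calc min (K * w x) N ^ (1 + δ) = min (K * w x) N * min (K * w x) N ^ δ := by
            rw [Real.rpow_add' h₀ (by linarith), Real.rpow_one]
        _ ≤ K * w x * (K * min (w x) N) ^ δ := by
            gcongr
            · exact mul_nonneg hK0.le (hw x)
            · exact min_le_left _ _
        _ = K ^ (1 + δ) * (w x * min (w x) N ^ δ) := by
            rw [Real.mul_rpow hK0.le (le_min (hw x) hN), Real.rpow_add hK0, Real.rpow_one]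
            ring
    have hhalf : ENNReal.ofReal (δ / (1 + δ)) * (ENNReal.ofReal (K ^ (1 + δ)) * A) ≤ A / 2 := by
      rw [← mul_assoc, ← ENNReal.ofReal_mul (by positivity), ENNReal.div_eq_inv_mul]
      refine mul_le_mul_left ?_ _
      rw [← ENNReal.ofReal_ofNat 2, ← ENNReal.ofReal_inv_of_pos two_pos]
      refine ENNReal.ofReal_le_ofReal ?_
      rw [← one_div]
      refine le_trans ?_ hδK
      gcongr
      exact div_le_self hδ.le (by linarith)
    have hfin : A / 2 ≠ ∞ := ENNReal.div_ne_top hAfin two_ne_zero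
    have h₂ : A / 2 + A / 2 ≤ ENNReal.ofReal (M ^ δ) * I + A / 2 := by
      rw [ENNReal.add_halves]
      exact hkey.trans (add_le_add_right ((mul_le_mul_right hg _).trans hhalf) _)
    have h₃ := (ENNReal.add_le_add_iff_right hfin).1 h₂
    rw [mul_assoc, two_mul, ← ENNReal.add_halves A]
    exact add_le_add h₃ h₃
  · intro t ht
    rcases lt_or_ge t N with htN | htN
    · simp only [lt_min_iff, htN, and_true]
      exact hA.measure_lt_le hw hwl (hM.trans ht) (h.trans (ENNReal.ofReal_le_ofReal ht))
    · simp [htN.not_gt]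

/-- An `A₁⁺` weight with constant `K` satisfies `w ≤ K w` almost everywhere. -/
theorem A1PlusWith.ae_le_mul {w : ℝ → ℝ} (hw : ∀ x, 0 ≤ w x)
    (hwl : LocallyIntegrable w volume) {K : ℝ} (hK : 0 ≤ K) (hA : A1PlusWith w K) :
    ∀ᵐ x, w x ≤ K * w x := by
  filter_upwards [hA, hwl.ae_exists_mul_sub_lt_integral] with x hx hx'
  refine le_of_forall_lt_imp_le_of_dense fun s hs => ?_
  rcases lt_or_ge s 0 with hs0 | hs0
  · exact hs0.le.trans (mul_nonneg hK (hw x))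
  obtain ⟨y, hy, hlt⟩ := hx' s hs (x - 1) (by linarith)
  exact ((ENNReal.ofReal_lt_ofReal_iff_of_nonneg hs0).1
    ((ofReal_lt_Mminus hw hwl hy.2 hlt hs0).trans_le hx)).le

/-- A weak reverse Hölder inequality for `A₁⁺` weights and sufficiently small exponents. -/
theorem A1PlusWith.lintegral_rpow_le {w : ℝ → ℝ} (hw : ∀ x, 0 ≤ w x)
    (hwl : LocallyIntegrable w volume) {K : ℝ} (hK : 0 < K) (hA : A1PlusWith w K) {δ : ℝ}
    (hδ : 0 < δ) (hδK : δ * K ^ (1 + δ) ≤ 1 / 2) (a b : ℝ) :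
    ∫⁻ x in Ioo a b, ENNReal.ofReal (w x ^ (1 + δ)) ≤
      2 * Mminus ((Ioo a b).indicator w) b ^ δ * ∫⁻ x in Ioo a b, ENNReal.ofReal (w x) := by
  have hwm : AEMeasurable w (volume.restrict (Ioo a b)) :=
    hwl.aestronglyMeasurable.aemeasurable.restrict
  have hzero (h : ∀ᵐ x ∂volume.restrict (Ioo a b), w x = 0) :
      ∫⁻ x in Ioo a b, ENNReal.ofReal (w x ^ (1 + δ)) = 0 := by
    refine lintegral_eq_zero_of_ae_eq_zero ?_
    filter_upwards [h] with x hx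
    simp [hx, Real.zero_rpow (by linarith : 1 + δ ≠ 0)]
  rcases lt_or_ge K 1 with hK1 | hK1
  · rw [hzero]
    · exact zero_le
    · filter_upwards [ae_restrict_of_ae (hA.ae_le_mul hw hwl hK.le)] with x hx
      nlinarith [hw x]
  rcases eq_or_ne (Mminus ((Ioo a b).indicator w) b) ∞ with hM | hM
  · rcases eq_or_ne (∫⁻ x in Ioo a b, ENNReal.ofReal (w x)) 0 with hI | hI
    · rw [hzero]
      · exact zero_le
      · filter_upwards [(lintegral_eq_zero_iff' hwm.ennreal_ofReal).1 hI] with x hx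
        exact le_antisymm (ENNReal.ofReal_eq_zero.1 hx) (hw x)
    · rw [hM, ENNReal.top_rpow_of_pos hδ, ENNReal.mul_top two_ne_zero, ENNReal.top_mul hI]
      exact le_top
  have hsup (x : ℝ) : ENNReal.ofReal (w x ^ (1 + δ)) =
      ⨆ n : ℕ, ENNReal.ofReal (w x) * ENNReal.ofReal (min (w x) n ^ δ) := by
    rw [Real.rpow_add' (hw x) (by linarith), Real.rpow_one, ENNReal.ofReal_mul (hw x)]
    refine le_antisymm ?_ (iSup_le fun n => ?_)
    · obtain ⟨n, hn⟩ := exists_nat_ge (w x)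
      exact le_iSup_of_le n (by rw [min_eq_left hn])
    · refine mul_le_mul_right (ENNReal.ofReal_le_ofReal ?_) _
      exact Real.rpow_le_rpow (le_min (hw x) n.cast_nonneg) (min_le_left _ _) hδ.le
  simp_rw [hsup]
  rw [lintegral_iSup']
  · refine iSup_le fun n => ?_
    refine (hA.lintegral_min_rpow_mul_le hw hwl hK1 hδ hδK ENNReal.toReal_nonneg
      (ENNReal.ofReal_toReal hM).ge n.cast_nonneg).trans_eq ?_
    rw [← ENNReal.ofReal_rpow_of_nonneg ENNReal.toReal_nonneg hδ.le, ENNReal.ofReal_toReal hM]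
  · exact fun n => hwm.ennreal_ofReal.mul
      ((hwm.min aemeasurable_const).pow_const δ).ennreal_ofReal
  · refine ae_of_all _ fun x m n hmn => mul_le_mul_right (ENNReal.ofReal_le_ofReal ?_) _
    exact Real.rpow_le_rpow (le_min (hw x) m.cast_nonneg)
      (min_le_min le_rfl (Nat.cast_le.2 hmn)) hδ.le

theorem one_div_mul_mul_rpow_le_half {c K : ℝ} (hc : 16 ≤ c) (hK : 0 < K) :
    1 / (c * K) * K ^ (1 + 1 / (c * K)) ≤ 1 / 2 := by
  have hc0 : 0 < c := by linarith
  have hexp : K ^ (1 / (c * K)) ≤ 3 := by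
    rw [Real.rpow_def_of_pos hK]
    refine (Real.exp_le_exp.2 (?_ : _ ≤ (1 : ℝ))).trans (by linarith [Real.exp_one_lt_d9])
    rw [mul_one_div, div_le_one (by positivity)]
    nlinarith [Real.log_le_sub_one_of_pos hK]
  rw [Real.rpow_add hK, Real.rpow_one, ← mul_assoc]
  have : 1 / (c * K) * K = 1 / c := by field_simp
  rw [this]
  have : 1 / c ≤ 1 / 16 := one_div_le_one_div_of_le (by norm_num) hc
  calc 1 / c * K ^ (1 / (c * K)) ≤ 1 / 16 * 3 := by gcongr
    _ ≤ 1 / 2 := by norm_num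

/-- sharp weak reverse Hölder inequality for `w ∈ A₁⁺` with
`r_w = 1 + 1/(16 e^{1/e} ‖w‖_{A₁⁺})`. -/
theorem stmt3 (w : ℝ → ℝ) (hw : ∀ x, 0 ≤ w x) (hwl : LocallyIntegrable w volume)
    (Kw : ℝ) (hKw : 0 < Kw) (hA : A1PlusWith w Kw)
    (a b : ℝ) (hab : a < b) :
    (∫⁻ t in Set.Ioo a b,
        ENNReal.ofReal (w t ^ (1 + 1 / (16 * Real.exp (1 / Real.exp 1) * Kw)))) ≤
      2 * (Mminus ((Set.Ioo a b).indicator w) b) ^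
          (1 + 1 / (16 * Real.exp (1 / Real.exp 1) * Kw) - 1) *
        ∫⁻ t in Set.Ioo a b, ENNReal.ofReal (w t) := by
  have hc : 16 ≤ 16 * Real.exp (1 / Real.exp 1) :=
    le_mul_of_one_le_right (by norm_num) (Real.one_le_exp (by positivity))
  rw [add_sub_cancel_left]
  exact hA.lintegral_rpow_le hw hwl hKw (by positivity) (one_div_mul_mul_rpow_le_half hc hKw) a b

end
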